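/- Let n ≥ 1 and 0 ≤ m ≤ k. The map (g, (q_0,…,q_n)) ↦ (g·q_0, …, g·q_n) is a homeomorphism from {monic polynomials of degree m over ℝ} × RX_{k−m,n}^{0} onto the subspace of (n+1)-tuples of monic degree-k real polynomials whose gcd in ℝ[z] has degree exactly m, i.e. the stratum RX_{k,n}^{m} − RX_{k,n}^{m−1}. (The decomposition underlying the long exact sequence in the proof of Proposition 4.1.) -/

import Mathlib

open Polynomial

/-- The monic real polynomial of degree `k` with lower-order coefficient vector `c`. -/
noncomputable def toPolyR (k : ℕ) (c : Fin k → ℝ) : Polynomial ℝ :=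
  Polynomial.X ^ k + ∑ i : Fin k, Polynomial.C (c i) * Polynomial.X ^ (i : ℕ)

/-- The monic complex polynomial of degree `k` with lower-order coefficient vector `c`. -/
noncomputable def toPolyC (k : ℕ) (c : Fin k → ℂ) : Polynomial ℂ :=
  Polynomial.X ^ k + ∑ i : Fin k, Polynomial.C (c i) * Polynomial.X ^ (i : ℕ)

/-- `RX_{k,n}^l`: tuples of monic real degree-`k` polynomials with gcd of degree `≤ l`,
as a subset of `ℝ^{k(n+1)}` via coefficient vectors. -/
def RXset (k n l : ℕ) : Set (Fin (n + 1) → Fin k → ℝ) :=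
  {f | (Finset.univ.gcd fun j => toPolyR k (f j)).natDegree ≤ l}

/-- `X_{k,n}^l`: tuples of monic complex degree-`k` polynomials with gcd of degree `≤ l`. -/
def Xset (k n l : ℕ) : Set (Fin (n + 1) → Fin k → ℂ) :=
  {f | (Finset.univ.gcd fun j => toPolyC k (f j)).natDegree ≤ l}

/-- `Y_{k,n}^l`: elements of `RX_{k,n}^l` with no common real root. -/
def Yset (k n l : ℕ) : Set (Fin (n + 1) → Fin k → ℝ) :=
  {f | f ∈ RXset k n l ∧ ∀ x : ℝ, ∃ j, (toPolyR k (f j)).eval x ≠ 0}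

lemma isMonicOfDegree_toPolyR (k : ℕ) (c : Fin k → ℝ) : IsMonicOfDegree (toPolyR k c) k :=
  have hlt := degree_sum_fin_lt c
  ⟨natDegree_eq_of_degree_eq_some (by
    rw [toPolyR, degree_add_eq_left_of_degree_lt (by simpa using hlt), degree_X_pow]),
    monic_X_pow_add hlt⟩

lemma coeff_toPolyR (k : ℕ) (c : Fin k → ℝ) (i : Fin k) : (toPolyR k c).coeff i = c i := by
  simp [toPolyR, coeff_X_pow, i.2.ne, Fin.val_inj]

lemma toPolyR_coeff {k : ℕ} {p : ℝ[X]} (hp : IsMonicOfDegree p k) :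
    toPolyR k (fun i => p.coeff i) = p := by
  obtain ⟨rfl, hm⟩ := hp
  conv_rhs => rw [hm.as_sum]
  rw [toPolyR, Fin.sum_univ_eq_sum_range fun i => C (p.coeff i) * X ^ i]

lemma toPolyR_injective (k : ℕ) : Function.Injective (toPolyR k) := fun c d h =>
  funext fun i => by rw [← coeff_toPolyR k c, h, coeff_toPolyR]

lemma continuous_coeff_toPolyR (k i : ℕ) :
    Continuous fun c : Fin k → ℝ => (toPolyR k c).coeff i := by
  simp only [toPolyR, coeff_add, finsetSum_coeff, coeff_C_mul]
  fun_prop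

/-- If `h` is monic, the coefficients of `g` are controlled by those of `g * h`. -/
lemma abs_coeff_le_of_monic_right (g : ℝ[X]) {h : ℝ[X]} (hh : h.Monic) (i : ℕ) :
    |g.coeff i| ≤ (g.natDegree).choose i * (g * h).sum fun _ a => ‖a‖ := by
  have hv : Isometry Complex.ofRealHom := Complex.isometry_ofReal
  calc |g.coeff i| ≤ (g.natDegree).choose i * g.mapMahlerMeasure Complex.ofRealHom :=
        norm_coeff_le_choose_mul_mapMahlerMeasure _ hv i g
    _ ≤ (g.natDegree).choose i * (g * h).mapMahlerMeasure Complex.ofRealHom := by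
        gcongr
        rw [mapMahlerMeasure_mul]
        exact le_mul_of_one_le_right (mapMahlerMeasure_nonneg _ _)
          (hh.one_le_mapMahlerMeasure _ hv)
    _ ≤ _ := by
        gcongr
        exact mapMahlerMeasure_le_sum_norm_coeff _ _ hv

lemma sum_norm_coeff_le {k : ℕ} {p : ℝ[X]} (hp : IsMonicOfDegree p k) {R : ℝ}
    (hR : ∀ i : Fin k, |p.coeff i| ≤ R) : (p.sum fun _ a => ‖a‖) ≤ k * R + 1 := by
  obtain ⟨rfl, hm⟩ := hp
  rw [sum_over_range _ (fun _ => norm_zero), Finset.sum_range_succ, hm.coeff_natDegree, norm_one]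
  gcongr
  refine (Finset.sum_le_card_nsmul _ _ R fun i hi => hR ⟨i, Finset.mem_range.1 hi⟩).trans ?_
  simp

/-- A factorization of a monic polynomial with bounded coefficients has a factor with bounded
coefficients. -/
lemma norm_le_of_isMonicOfDegree_mul {m k : ℕ} (g : Fin m → ℝ) {h : ℝ[X]} (hh : h.Monic)
    (hp : IsMonicOfDegree (toPolyR m g * h) k) {R : ℝ} (hR₀ : 0 ≤ R)
    (hR : ∀ i : Fin k, |(toPolyR m g * h).coeff i| ≤ R) :
    ‖g‖ ≤ 2 ^ m * (k * R + 1) := by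
  refine (pi_norm_le_iff_of_nonneg (by positivity)).2 fun i => ?_
  have h1 := abs_coeff_le_of_monic_right (toPolyR m g) hh i
  rw [coeff_toPolyR, (isMonicOfDegree_toPolyR m g).natDegree_eq] at h1
  refine h1.trans ?_
  gcongr
  · exact Finset.sum_nonneg fun _ _ => norm_nonneg _
  · exact_mod_cast Nat.choose_le_two_pow m i
  · exact sum_norm_coeff_le hp hR

/-- The map `(g, q) ↦ (g·q_0, …, g·q_n)` on coefficient vectors. -/
noncomputable def mulTuple (n k m l : ℕ) (x : (Fin m → ℝ) × (Fin (n + 1) → Fin l → ℝ)) :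
    Fin (n + 1) → Fin k → ℝ :=
  fun j i => (toPolyR m x.1 * toPolyR l (x.2 j)).coeff i

lemma toPolyR_mulTuple {n k m l : ℕ} (hk : m + l = k)
    (x : (Fin m → ℝ) × (Fin (n + 1) → Fin l → ℝ)) (j : Fin (n + 1)) :
    toPolyR k (mulTuple n k m l x j) = toPolyR m x.1 * toPolyR l (x.2 j) :=
  toPolyR_coeff (hk ▸ (isMonicOfDegree_toPolyR m x.1).mul (isMonicOfDegree_toPolyR l (x.2 j)))

lemma continuous_mulTuple (n k m l : ℕ) : Continuous (mulTuple n k m l) := by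
  refine continuous_pi fun j => continuous_pi fun i => ?_
  simp only [mulTuple, coeff_mul]
  exact continuous_finsetSum _ fun a _ =>
    ((continuous_coeff_toPolyR m a.1).comp continuous_fst).mul
      ((continuous_coeff_toPolyR l a.2).comp ((continuous_apply j).comp continuous_snd))

lemma isProperMap_mulTuple {n k m l : ℕ} (hk : m + l = k) : IsProperMap (mulTuple n k m l) := by
  refine isProperMap_iff_isCompact_preimage.2 ⟨continuous_mulTuple n k m l, fun K hK => ?_⟩
  obtain ⟨R, hR₀, hR⟩ := hK.isBounded.exists_pos_norm_le
  refine Metric.isCompact_of_isClosed_isBounded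
    (hK.isClosed.preimage (continuous_mulTuple n k m l)) ?_
  refine isBounded_iff_forall_norm_le.2
    ⟨max (2 ^ m * (k * R + 1)) (2 ^ l * (k * R + 1)), fun x hx => ?_⟩
  have hcoeff (j : Fin (n + 1)) (i : Fin k) :
      |(toPolyR m x.1 * toPolyR l (x.2 j)).coeff i| ≤ R :=
    (norm_le_pi_norm (mulTuple n k m l x j) i).trans
      ((norm_le_pi_norm (mulTuple n k m l x) j).trans (hR _ hx))
  have hdeg (j : Fin (n + 1)) : IsMonicOfDegree (toPolyR m x.1 * toPolyR l (x.2 j)) k :=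
    hk ▸ (isMonicOfDegree_toPolyR m x.1).mul (isMonicOfDegree_toPolyR l (x.2 j))
  refine norm_prod_le_iff.2 ⟨le_max_of_le_left ?_, le_max_of_le_right ?_⟩
  · exact norm_le_of_isMonicOfDegree_mul x.1 (isMonicOfDegree_toPolyR l (x.2 0)).monic (hdeg 0)
      hR₀.le (hcoeff 0)
  · refine (pi_norm_le_iff_of_nonneg (by positivity)).2 fun j => ?_
    exact norm_le_of_isMonicOfDegree_mul (x.2 j) (isMonicOfDegree_toPolyR m x.1).monic
      (mul_comm (toPolyR m x.1) _ ▸ hdeg j) hR₀.le (mul_comm (toPolyR m x.1) _ ▸ hcoeff j)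

lemma gcd_toPolyR_ne_zero {n k : ℕ} (f : Fin (n + 1) → Fin k → ℝ) :
    (Finset.univ.gcd fun j => toPolyR k (f j)) ≠ 0 := fun h =>
  (isMonicOfDegree_toPolyR k (f 0)).ne_zero (Finset.gcd_eq_zero_iff.1 h 0 (Finset.mem_univ 0))

lemma monic_gcd_toPolyR {n k : ℕ} (f : Fin (n + 1) → Fin k → ℝ) :
    (Finset.univ.gcd fun j => toPolyR k (f j)).Monic := by
  rw [← Finset.normalize_gcd]
  exact monic_normalize (gcd_toPolyR_ne_zero f)

lemma associated_gcd_mulTuple {n k m l : ℕ} (hk : m + l = k)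
    (x : (Fin m → ℝ) × (Fin (n + 1) → Fin l → ℝ)) :
    Associated (Finset.univ.gcd fun j => toPolyR k (mulTuple n k m l x j))
      (toPolyR m x.1 * Finset.univ.gcd fun j => toPolyR l (x.2 j)) := by
  simp only [toPolyR_mulTuple hk]
  exact Finset.gcd_mul_left' _ _ _

/-- The tuple `(g·q_0, …, g·q_n)` has a gcd of degree exactly `deg g` iff the `q_j` are coprime. -/
lemma natDegree_gcd_mulTuple_eq_iff {n k m l : ℕ} (hk : m + l = k)
    (x : (Fin m → ℝ) × (Fin (n + 1) → Fin l → ℝ)) :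
    (Finset.univ.gcd fun j => toPolyR k (mulTuple n k m l x j)).natDegree = m ↔
      x.2 ∈ RXset l n 0 := by
  have hg := isMonicOfDegree_toPolyR m x.1
  rw [natDegree_eq_of_degree_eq (degree_eq_degree_of_associated (associated_gcd_mulTuple hk x)),
    natDegree_mul hg.ne_zero (gcd_toPolyR_ne_zero _), hg.natDegree_eq, RXset, Set.mem_ofPred_eq]
  omega

lemma gcd_mulTuple_eq {n k m l : ℕ} (hk : m + l = k)
    (x : (Fin m → ℝ) × (Fin (n + 1) → Fin l → ℝ)) (hx : x.2 ∈ RXset l n 0) :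
    (Finset.univ.gcd fun j => toPolyR k (mulTuple n k m l x j)) = toPolyR m x.1 := by
  refine eq_of_monic_of_associated (monic_gcd_toPolyR _) (isMonicOfDegree_toPolyR m x.1).monic ?_
  have h := associated_gcd_mulTuple hk x
  rwa [(monic_gcd_toPolyR x.2).natDegree_eq_zero.1 (Nat.le_zero.1 hx), mul_one] at h

lemma eq_of_mulTuple_eq {n k m l : ℕ} (hk : m + l = k)
    {x y : (Fin m → ℝ) × (Fin (n + 1) → Fin l → ℝ)} (hx : x.2 ∈ RXset l n 0)
    (hy : y.2 ∈ RXset l n 0) (h : mulTuple n k m l x = mulTuple n k m l y) : x = y := by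
  obtain ⟨g, q⟩ := x
  obtain ⟨g', q'⟩ := y
  have hg : g = g' := toPolyR_injective m <| by
    rw [← gcd_mulTuple_eq hk (g, q) hx, h, gcd_mulTuple_eq hk (g', q') hy]
  subst hg
  refine Prod.ext rfl (funext fun j => toPolyR_injective l ?_)
  refine mul_left_cancel₀ (isMonicOfDegree_toPolyR m g).ne_zero ?_
  rw [← toPolyR_mulTuple hk (g, q), h, toPolyR_mulTuple hk]

lemma exists_mulTuple_eq {n k m l : ℕ} (hk : m + l = k) (f : Fin (n + 1) → Fin k → ℝ)
    (hf : (Finset.univ.gcd fun j => toPolyR k (f j)).natDegree = m) :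
    ∃ x, mulTuple n k m l x = f := by
  have hd : IsMonicOfDegree (Finset.univ.gcd fun j => toPolyR k (f j)) m :=
    ⟨hf, monic_gcd_toPolyR f⟩
  choose q hq using fun j =>
    Finset.gcd_dvd (f := fun j => toPolyR k (f j)) (Finset.mem_univ j)
  have hqdeg (j : Fin (n + 1)) : IsMonicOfDegree (q j) l :=
    hd.of_mul_left (by rw [hk, ← hq j]; exact isMonicOfDegree_toPolyR k (f j))
  refine ⟨(fun i => (Finset.univ.gcd fun j => toPolyR k (f j)).coeff i,
    fun j i => (q j).coeff i), funext fun j => toPolyR_injective k ?_⟩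
  rw [toPolyR_mulTuple hk, toPolyR_coeff hd, toPolyR_coeff (hqdeg j), ← hq j]

/-- The restriction of `mulTuple` to coprime tuples, as a map onto the stratum of tuples with gcd
of degree exactly `m`. -/
noncomputable def mulStratum {n k m l : ℕ} (hk : m + l = k)
    (x : (Fin m → ℝ) × ↥(RXset l n 0)) :
    ↥{f : Fin (n + 1) → Fin k → ℝ | (Finset.univ.gcd fun j => toPolyR k (f j)).natDegree = m} :=
  ⟨mulTuple n k m l (x.1, x.2.1), (natDegree_gcd_mulTuple_eq_iff hk (x.1, x.2.1)).2 x.2.2⟩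

lemma continuous_mulStratum {n k m l : ℕ} (hk : m + l = k) :
    Continuous (mulStratum (n := n) hk) :=
  ((continuous_mulTuple n k m l).comp
    (continuous_id.prodMap continuous_subtype_val)).subtype_mk _

lemma bijective_mulStratum {n k m l : ℕ} (hk : m + l = k) :
    Function.Bijective (mulStratum (n := n) hk) := by
  constructor
  · intro x y h
    have hxy : (x.1, x.2.1) = (y.1, y.2.1) :=
      eq_of_mulTuple_eq hk x.2.2 y.2.2 (Subtype.ext_iff.1 h)
    exact Prod.ext (Prod.mk.inj hxy).1 (Subtype.ext (Prod.mk.inj hxy).2)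
  · rintro ⟨f, hf⟩
    obtain ⟨x, rfl⟩ := exists_mulTuple_eq hk f hf
    exact ⟨(x.1, ⟨x.2, (natDegree_gcd_mulTuple_eq_iff hk x).1 hf⟩), rfl⟩

lemma isClosedMap_mulStratum {n k m l : ℕ} (hk : m + l = k) :
    IsClosedMap (mulStratum (n := n) hk) := by
  intro s hs
  have hι : Topology.IsInducing
      (Prod.map id Subtype.val : (Fin m → ℝ) × ↥(RXset l n 0) → _) :=
    Topology.IsInducing.id.prodMap .subtypeVal
  obtain ⟨t, ht, rfl⟩ := hι.isClosed_iff.1 hs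
  refine isClosed_induced_iff.2
    ⟨mulTuple n k m l '' t, (isProperMap_mulTuple hk).isClosedMap t ht, ?_⟩
  ext ⟨f, hf⟩
  constructor
  · rintro ⟨x, hx, rfl⟩
    exact ⟨(x.1, ⟨x.2, (natDegree_gcd_mulTuple_eq_iff hk x).1 hf⟩), hx, rfl⟩
  · rintro ⟨x, hx, h⟩
    exact ⟨(x.1, x.2.1), hx, congrArg Subtype.val h⟩

/-- **Decomposition for Proposition 4.1.** The stratum `RX_{k,n}^{m} − RX_{k,n}^{m−1}` of tuples
of monic real degree-`k` polynomials whose gcd has degree exactly `m` is homeomorphic to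
{monic real polynomials of degree `m`} × `RX_{k−m,n}^0` via
`(g, (q_0,…,q_n)) ↦ (g·q_0, …, g·q_n)`. -/
theorem stratum_homeo_RX (n k m : ℕ) (hn : 1 ≤ n) (hm : m ≤ k) :
    ∃ H : ((Fin m → ℝ) × ↥(RXset (k - m) n 0)) ≃ₜ
        ↥{f : Fin (n + 1) → Fin k → ℝ |
            (Finset.univ.gcd fun j => toPolyR k (f j)).natDegree = m},
      ∀ (g : Fin m → ℝ) (q : ↥(RXset (k - m) n 0)) (j : Fin (n + 1)) (i : Fin k),
        (H (g, q)).val j i = (toPolyR m g * toPolyR (k - m) (q.val j)).coeff i := by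
  have hk : m + (k - m) = k := Nat.add_sub_cancel' hm
  exact ⟨(Equiv.ofBijective _ (bijective_mulStratum hk)).toHomeomorphOfContinuousClosed
    (continuous_mulStratum hk) (isClosedMap_mulStratum hk), fun _ _ _ _ => rfl⟩
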